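/- arXiv:1110.2841 — 2 statements merged into one kernel-verified Lean document; each statement's English description precedes it below -/
import Mathlib

section
/- Let G be a finite simple graph on n vertices with at least one edge, let χ = χ(G^c) be the chromatic number of the complement graph G^c, and let (x, y) be a ((χ−1)/χ)-max edge of G with d = deg(x) ≥ deg(y) = e. Then pd(G) ≤ n(1 − 1/(d + ((χ−1)/χ)·e + 1)). -/
open CategoryTheory
open scoped ENNReal

noncomputable def projDim (R : Type) [CommRing R] (M : ModuleCat R) : ℕ∞ :=
  sSup {n : ℕ∞ | ∃ (i : ℕ) (N : ModuleCat R), n = i ∧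
    Nontrivial (((Ext R (ModuleCat R) i).obj (Opposite.op M)).obj N)}

noncomputable def edgeIdeal (K : Type) [Field K] {V : Type} (G : SimpleGraph V) :
    Ideal (MvPolynomial V K) :=
  Ideal.span {m | ∃ u v, G.Adj u v ∧ m = MvPolynomial.X u * MvPolynomial.X v}

noncomputable def graphPd (K : Type) [Field K] {V : Type} (G : SimpleGraph V) : ℕ∞ :=
  projDim (MvPolynomial V K)
    (ModuleCat.of (MvPolynomial V K) (MvPolynomial V K ⧸ edgeIdeal K G))

/-- `(x, y)` is an `α`-max edge of `G`: it is an edge maximizing `deg x + α · deg y`. -/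
def IsAlphaMaxEdge {V : Type} (G : SimpleGraph V) (α : ℝ) (x y : V) : Prop :=
  G.Adj x y ∧ ∀ u v : V, G.Adj u v →
    ((G.neighborSet u).ncard : ℝ) + α * (G.neighborSet v).ncard ≤
      ((G.neighborSet x).ncard : ℝ) + α * (G.neighborSet y).ncard

theorem isZero_ext_of_hasProjectiveDimensionLT {R : Type} [CommRing R] (M N : ModuleCat R)
    (i n : ℕ) [HasProjectiveDimensionLT M n] (hi : n ≤ i) (hpos : i ≠ 0) :
    Limits.IsZero (((Ext R (ModuleCat R) i).obj (Opposite.op M)).obj N) := by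
  obtain ⟨p, rfl⟩ := Nat.exists_eq_succ_of_ne_zero hpos
  let P := projectiveResolution M
  refine Limits.IsZero.of_iso ?_ (P.isoExt (p + 1) N)
  rw [← HomologicalComplex.exactAt_iff_isZero_homology,
    HomologicalComplex.exactAt_iff' _ p (p + 1) (p + 2) (by simp) (by simp),
    ShortComplex.moduleCat_exact_iff]
  intro f hf
  obtain ⟨g, hg⟩ := (P.extMk_eq_zero_iff f (p + 2) rfl hf p rfl).1
    (Abelian.Ext.eq_zero_of_hasProjectiveDimensionLT _ n hi)
  exact ⟨g, hg⟩

theorem projDim_le {R : Type} [CommRing R] (M : ModuleCat R) (n : ℕ)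
    [HasProjectiveDimensionLT M (n + 1)] : projDim R M ≤ n := by
  refine sSup_le ?_
  rintro _ ⟨i, N, rfl, hN⟩
  by_contra hlt
  rw [not_le, Nat.cast_lt] at hlt
  have := ModuleCat.subsingleton_of_isZero
    (isZero_ext_of_hasProjectiveDimensionLT M N i (n + 1) hlt (by lia))
  exact not_subsingleton _ this

/-- The short exact sequence `0 → R/J → R/I → R/L → 0`, where `J` is the colon ideal `I : x`
and `L = I + (x)`. -/
theorem exists_colon_shortExact {R : Type} [CommRing R] {I J L : Ideal R} {x : R}
    (hJ : ∀ f, f ∈ J ↔ f * x ∈ I) (hL : L = I ⊔ Ideal.span {x}) :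
    ∃ (f : ModuleCat.of R (R ⧸ J) ⟶ ModuleCat.of R (R ⧸ I))
      (g : ModuleCat.of R (R ⧸ I) ⟶ ModuleCat.of R (R ⧸ L)) (w : f ≫ g = 0),
      (ShortComplex.mk f g w).ShortExact := by
  have hIL : I ≤ L := hL ▸ le_sup_left
  have hxL : x ∈ L := hL ▸ (le_sup_right (a := I) (Ideal.mem_span_singleton_self x))
  let φ : (R ⧸ J) →ₗ[R] (R ⧸ I) :=
    Submodule.mapQ J I (LinearMap.mulRight R x) fun f hf ↦ (hJ f).1 hf
  let ψ : (R ⧸ I) →ₗ[R] (R ⧸ L) := Submodule.mapQ I L LinearMap.id hIL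
  have hφ : Function.Injective φ := by
    rw [← LinearMap.ker_eq_bot, LinearMap.ker_eq_bot']
    intro a ha
    obtain ⟨a, rfl⟩ := Submodule.mkQ_surjective J a
    exact (Submodule.Quotient.mk_eq_zero J).2
      ((hJ a).2 ((Submodule.Quotient.mk_eq_zero I).1 ha))
  have hψ : Function.Surjective ψ := fun b ↦ by
    obtain ⟨b, rfl⟩ := Submodule.mkQ_surjective L b
    exact ⟨Submodule.mkQ I b, rfl⟩
  have hex : Function.Exact φ ψ := by
    intro b
    constructor
    · intro hb
      obtain ⟨b, rfl⟩ := Submodule.mkQ_surjective I b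
      have hb : b ∈ L := (Submodule.Quotient.mk_eq_zero L).1 hb
      rw [hL, Submodule.mem_sup] at hb
      obtain ⟨i, hi, y, hy, rfl⟩ := hb
      obtain ⟨a, rfl⟩ := Ideal.mem_span_singleton'.1 hy
      refine ⟨Submodule.mkQ J a, ?_⟩
      change Submodule.Quotient.mk (a * x) = Submodule.Quotient.mk (i + a * x)
      rw [Submodule.Quotient.eq]
      simpa using hi
    · rintro ⟨a, rfl⟩
      obtain ⟨a, rfl⟩ := Submodule.mkQ_surjective J a
      exact (Submodule.Quotient.mk_eq_zero L).2 (L.mul_mem_left a hxL)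
  refine ⟨ModuleCat.ofHom φ, ModuleCat.ofHom ψ, ?_, ?_⟩
  · exact ModuleCat.hom_ext (LinearMap.ext fun a ↦ hex.apply_apply_eq_zero a)
  · refine ShortComplex.ShortExact.mk' ?_ ?_ ?_
    · rw [ShortComplex.ShortExact.moduleCat_exact_iff_function_exact]
      exact hex
    · exact (ModuleCat.mono_iff_injective _).2 hφ
    · exact (ModuleCat.epi_iff_surjective _).2 hψ

section

open MvPolynomial

/-- The ideal of `K[x_v : v ∈ V]` generated by the edge monomials of the induced subgraph `G[T]`
and the variables in `Z`, described through the monomials it contains. -/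
noncomputable def edgeVarIdeal (K : Type) [Field K] {V : Type} (G : SimpleGraph V)
    (T Z : Finset V) : Ideal (MvPolynomial V K) :=
  restrictSupportIdeal K
    {m : V →₀ ℕ | (∃ u ∈ T, ∃ v ∈ T, G.Adj u v ∧ m u ≠ 0 ∧ m v ≠ 0) ∨ ∃ z ∈ Z, m z ≠ 0} (by
      rintro a b hab (⟨u, hu, v, hv, h, hmu, hmv⟩ | ⟨z, hz, hmz⟩)
      · have := hab u
        have := hab v
        exact .inl ⟨u, hu, v, hv, h, by lia, by lia⟩
      · have := hab z
        exact .inr ⟨z, hz, by lia⟩)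

variable {K : Type} [Field K] {V : Type} {G : SimpleGraph V}

theorem mem_edgeVarIdeal {T Z : Finset V} {f : MvPolynomial V K} :
    f ∈ edgeVarIdeal K G T Z ↔ ∀ m ∈ f.support,
      (∃ u ∈ T, ∃ v ∈ T, G.Adj u v ∧ m u ≠ 0 ∧ m v ≠ 0) ∨ ∃ z ∈ Z, m z ≠ 0 :=
  Iff.rfl

theorem edgeIdeal_eq_edgeVarIdeal [Fintype V] :
    edgeIdeal K G = edgeVarIdeal K G Finset.univ ∅ := by
  classical
  have key : {m : MvPolynomial V K | ∃ u v, G.Adj u v ∧ m = X u * X v} =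
      (fun s ↦ monomial s (1 : K)) ''
        {s | ∃ u v, G.Adj u v ∧ s = Finsupp.single u 1 + Finsupp.single v 1} := by
    ext m
    constructor
    · rintro ⟨u, v, h, rfl⟩
      exact ⟨_, ⟨u, v, h, rfl⟩, by simp [X, monomial_mul]⟩
    · rintro ⟨_, ⟨u, v, h, rfl⟩, rfl⟩
      exact ⟨u, v, h, by simp [X, monomial_mul]⟩
  ext f
  rw [edgeIdeal, key, mem_ideal_span_monomial_image, mem_edgeVarIdeal]
  refine forall₂_congr fun m _ ↦ ?_
  constructor
  · rintro ⟨_, ⟨u, v, h, rfl⟩, hle⟩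
    refine .inl ⟨u, Finset.mem_univ _, v, Finset.mem_univ _, h, ?_, ?_⟩
    · have := hle u
      simp at this
      lia
    · have := hle v
      simp at this
      lia
  · rintro (⟨u, -, v, -, h, hu, hv⟩ | ⟨z, hz, -⟩)
    · refine ⟨_, ⟨u, v, h, rfl⟩, fun w ↦ ?_⟩
      have := h.ne
      simp only [Finsupp.add_apply, Finsupp.single_apply]
      split_ifs <;> subst_vars <;> lia
    · simp at hz

theorem mul_X_mem_edgeVarIdeal [DecidableEq V] [DecidableRel G.Adj] {T Z : Finset V} {x : V}
    (hx : x ∈ T) (hxZ : x ∉ Z) (f : MvPolynomial V K) :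
    f ∈ edgeVarIdeal K G ((T.erase x).filter fun v ↦ ¬ G.Adj x v) (Z ∪ T.filter (G.Adj x)) ↔
      f * X x ∈ edgeVarIdeal K G T Z := by
  simp only [mem_edgeVarIdeal, support_mul_X, Finset.forall_mem_map, addRightEmbedding_apply,
    Finsupp.add_apply]
  refine forall₂_congr fun m _ ↦ ?_
  have hs (v : V) : m v + Finsupp.single x 1 v ≠ 0 ↔ m v ≠ 0 ∨ v = x := by
    rw [Finsupp.single_apply]
    split_ifs with h <;> simp [h, eq_comm]
  simp only [hs, Finset.mem_filter, Finset.mem_erase, Finset.mem_union]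
  constructor
  · rintro (⟨u, ⟨⟨-, hu⟩, -⟩, v, ⟨⟨-, hv⟩, -⟩, h, hmu, hmv⟩ | ⟨z, hz | ⟨hz, hxz⟩, hmz⟩)
    · exact .inl ⟨u, hu, v, hv, h, .inl hmu, .inl hmv⟩
    · exact .inr ⟨z, hz, .inl hmz⟩
    · exact .inl ⟨x, hx, z, hz, hxz, .inr rfl, .inl hmz⟩
  · rintro (⟨u, hu, v, hv, h, hmu, hmv⟩ | ⟨z, hz, hmz | rfl⟩)
    · have := h.ne
      have := h.symm
      by_cases hxu : G.Adj x u
      · by_cases h0 : m u ≠ 0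
        · exact .inr ⟨u, .inr ⟨hu, hxu⟩, h0⟩
        · obtain rfl := hmu.resolve_left h0
          exact absurd rfl hxu.ne
      by_cases hxv : G.Adj x v
      · by_cases h0 : m v ≠ 0
        · exact .inr ⟨v, .inr ⟨hv, hxv⟩, h0⟩
        · obtain rfl := hmv.resolve_left h0
          exact absurd rfl hxv.ne
      have hux : u ≠ x := by rintro rfl; exact hxv h
      have hvx : v ≠ x := by rintro rfl; exact hxu h.symm
      exact .inl ⟨u, ⟨⟨hux, hu⟩, hxu⟩, v, ⟨⟨hvx, hv⟩, hxv⟩, h, hmu.resolve_right hux,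
        hmv.resolve_right hvx⟩
    · exact .inr ⟨z, .inl hz, hmz⟩
    · exact absurd hz hxZ

theorem mul_X_mem_edgeVarIdeal_empty {Z : Finset V} {x : V} (hxZ : x ∉ Z)
    (f : MvPolynomial V K) :
    f ∈ edgeVarIdeal K G ∅ Z ↔ f * X x ∈ edgeVarIdeal K G ∅ Z := by
  simp only [mem_edgeVarIdeal, support_mul_X, Finset.forall_mem_map, addRightEmbedding_apply,
    Finsupp.add_apply]
  refine forall₂_congr fun m _ ↦ or_congr (by simp) (exists_congr fun z ↦ and_congr_right ?_)
  intro hz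
  rw [Finsupp.single_eq_of_ne (by rintro rfl; exact hxZ hz), add_zero]

theorem edgeVarIdeal_erase_insert [DecidableEq V] {T Z : Finset V} {x : V} :
    edgeVarIdeal K G (T.erase x) (insert x Z) = edgeVarIdeal K G T Z ⊔ Ideal.span {X x} := by
  apply le_antisymm
  · intro f hf
    rw [mem_edgeVarIdeal] at hf
    rw [f.as_sum]
    refine Ideal.sum_mem _ fun m hm ↦ ?_
    by_cases hx : m x = 0
    · refine Ideal.mem_sup_left ?_
      intro m' hm'
      obtain rfl : m' = m := by simpa using support_monomial_subset hm'
      obtain ⟨u, hu, v, hv, h⟩ | ⟨z, hz, hmz⟩ := hf m' hm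
      · exact .inl ⟨u, Finset.mem_of_mem_erase hu, v, Finset.mem_of_mem_erase hv, h⟩
      · obtain rfl | hz := Finset.mem_insert.1 hz
        · exact absurd hx hmz
        · exact .inr ⟨z, hz, hmz⟩
    · refine Ideal.mem_sup_right (Ideal.mem_span_singleton.2 ?_)
      exact (X_dvd_monomial).2 (.inr hx)
  · refine sup_le ?_ ?_
    · intro f hf
      rw [mem_edgeVarIdeal] at hf ⊢
      intro m hm
      obtain ⟨u, hu, v, hv, h, hmu, hmv⟩ | ⟨z, hz, hmz⟩ := hf m hm
      · by_cases hux : u = x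
        · exact .inr ⟨u, by simp [hux], hmu⟩
        by_cases hvx : v = x
        · exact .inr ⟨v, by simp [hvx], hmv⟩
        exact .inl ⟨u, Finset.mem_erase.2 ⟨hux, hu⟩, v, Finset.mem_erase.2 ⟨hvx, hv⟩, h, hmu, hmv⟩
      · exact .inr ⟨z, Finset.mem_insert_of_mem hz, hmz⟩
    · rw [Ideal.span_singleton_le_iff_mem, mem_edgeVarIdeal]
      intro m hm
      rw [support_X, Finset.mem_singleton] at hm
      subst hm
      exact .inr ⟨x, by simp, by simp⟩

theorem edgeVarIdeal_erase_of_isolated [DecidableEq V] {T Z : Finset V} {w : V}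
    (hw : ∀ v ∈ T, ¬ G.Adj w v) : edgeVarIdeal K G (T.erase w) Z = edgeVarIdeal K G T Z := by
  ext f
  simp only [mem_edgeVarIdeal]
  refine forall₂_congr fun m _ ↦ or_congr ⟨?_, ?_⟩ Iff.rfl
  · rintro ⟨u, hu, v, hv, h⟩
    exact ⟨u, Finset.mem_of_mem_erase hu, v, Finset.mem_of_mem_erase hv, h⟩
  · rintro ⟨u, hu, v, hv, h, hm⟩
    refine ⟨u, Finset.mem_erase.2 ⟨?_, hu⟩, v, Finset.mem_erase.2 ⟨?_, hv⟩, h, hm⟩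
    · rintro rfl; exact hw v hv h
    · rintro rfl; exact hw u hu h.symm

/-- `pd (S / edgeVarIdeal K G T Z) ≤ n`. -/
def EdgeVarPdLE (K : Type) [Field K] (G : SimpleGraph V) (T Z : Finset V) (n : ℕ) : Prop :=
  HasProjectiveDimensionLT
    (ModuleCat.of (MvPolynomial V K) (MvPolynomial V K ⧸ edgeVarIdeal K G T Z)) (n + 1)

theorem EdgeVarPdLE.mono {T Z : Finset V} {m n : ℕ} (h : EdgeVarPdLE K G T Z m) (hmn : m ≤ n) :
    EdgeVarPdLE K G T Z n :=
  @hasProjectiveDimensionLT_of_ge _ _ _ _ (m + 1) _ (by lia) h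

theorem edgeVarPdLE_empty (Z : Finset V) : EdgeVarPdLE K G ∅ Z Z.card := by
  classical
  induction Z using Finset.induction_on with
  | empty =>
    have h : edgeVarIdeal K G ∅ ∅ = ⊥ := by
      ext f
      simp [mem_edgeVarIdeal, ← support_eq_empty, Finset.eq_empty_iff_forall_notMem]
    rw [EdgeVarPdLE, h]
    have : Projective (ModuleCat.of (MvPolynomial V K) (MvPolynomial V K)) :=
      inferInstance
    exact hasProjectiveDimensionLT_of_iso
      (Submodule.quotEquivOfEqBot (⊥ : Ideal (MvPolynomial V K)) rfl).symm.toModuleIso 1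
  | insert x Z hx ih =>
    have hL : edgeVarIdeal K G ∅ (insert x Z) = edgeVarIdeal K G ∅ Z ⊔ Ideal.span {X x} := by
      rw [← edgeVarIdeal_erase_insert, Finset.erase_empty]
    obtain ⟨f, g, w, hs⟩ := exists_colon_shortExact (mul_X_mem_edgeVarIdeal_empty hx) hL
    rw [Finset.card_insert_of_notMem hx]
    exact hs.hasProjectiveDimensionLT_X₃ _ ih (ih.mono (Nat.le_succ _))

theorem edgeVarPdLE_of_colon [DecidableEq V] [DecidableRel G.Adj] {T Z : Finset V} {x : V} {n : ℕ}
    (hx : x ∈ T) (hxZ : x ∉ Z)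
    (h₁ : EdgeVarPdLE K G ((T.erase x).filter fun v ↦ ¬ G.Adj x v) (Z ∪ T.filter (G.Adj x)) n)
    (h₂ : EdgeVarPdLE K G (T.erase x) (insert x Z) n) : EdgeVarPdLE K G T Z n := by
  obtain ⟨f, g, w, hs⟩ := exists_colon_shortExact (mul_X_mem_edgeVarIdeal (K := K) (G := G) hx hxZ)
    (edgeVarIdeal_erase_insert (x := x))
  exact hs.hasProjectiveDimensionLT_X₂ _ h₁ h₂

/-- Split off the vertices of `A` one at a time, those of `A ∩ B` first. It suffices to bound the
projective dimension once all of `A` has been removed, and for each colon ideal on the way. -/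
theorem EdgeVarPdLE.chain [DecidableEq V] {T Z A B : Finset V} {n : ℕ}
    (hA : A ⊆ T) (hTZ : Disjoint T Z)
    (hend : EdgeVarPdLE K G (T \ A) (Z ∪ A) n)
    (hstep : ∀ v ∈ A, ∀ R ⊆ A, v ∉ R → (R ⊆ B ∧ v ∈ B ∨ v ∉ B) →
      ∀ T' Z' : Finset V, Disjoint T' Z' → T'.card + Z'.card + 1 = T.card + Z.card →
      (∀ u ∈ T, u ∉ R → u ∉ T' → u = v ∨ G.Adj v u) → v ∉ T' → T' ⊆ T → EdgeVarPdLE K G T' Z' n)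
    (R : Finset V) (hR : R ⊆ A) (hB : R ⊆ B ∨ A ∩ B ⊆ R) :
    EdgeVarPdLE K G (T \ R) (Z ∪ R) n := by
  classical
  induction hk : (A \ R).card using Nat.strong_induction_on generalizing R with
  | _ k ih =>
  obtain h | hne := (A \ R).eq_empty_or_nonempty
  · obtain rfl : R = A := hR.antisymm (Finset.sdiff_eq_empty_iff_subset.1 h)
    exact hend
  obtain ⟨v, hv, hvB⟩ : ∃ v ∈ A \ R, R ⊆ B ∧ v ∈ B ∨ v ∉ B ∧ A ∩ B ⊆ R := by
    by_cases hAB : A ∩ B ⊆ R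
    · obtain ⟨v, hv⟩ := hne
      refine ⟨v, hv, .inr ⟨fun h ↦ ?_, hAB⟩⟩
      rw [Finset.mem_sdiff] at hv
      exact hv.2 (hAB (Finset.mem_inter.2 ⟨hv.1, h⟩))
    · obtain ⟨v, hv, hvR⟩ := Finset.not_subset.1 hAB
      rw [Finset.mem_inter] at hv
      exact ⟨v, Finset.mem_sdiff.2 ⟨hv.1, hvR⟩, .inl ⟨hB.resolve_right hAB, hv.2⟩⟩
  rw [Finset.mem_sdiff] at hv
  have hvT := hA hv.1
  have hRT := hR.trans hA
  have hvZ : v ∉ Z := Finset.disjoint_left.1 hTZ hvT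
  refine edgeVarPdLE_of_colon (x := v) (by simp [hvT, hv.2]) (by simp [hvZ, hv.2]) ?_ ?_
  · refine hstep v hv.1 R hR hv.2 (hvB.imp_right And.left) _ _ ?_ ?_ ?_ (by simp) ?_
    · rw [Finset.disjoint_left]
      intro u hu
      simp only [Finset.mem_filter, Finset.mem_erase, Finset.mem_sdiff, Finset.mem_union] at hu ⊢
      have := Finset.disjoint_left.1 hTZ hu.1.2.1
      tauto
    · rw [Finset.card_union_of_disjoint, Finset.card_union_of_disjoint]
      · have h₁ := Finset.card_filter_add_card_filter_not (s := (T \ R).erase v) (G.Adj v)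
        have h₂ : ((T \ R).erase v).filter (G.Adj v) = (T \ R).filter (G.Adj v) := by
          ext u
          simp only [Finset.mem_filter, Finset.mem_erase]
          exact ⟨fun h ↦ ⟨h.1.2, h.2⟩, fun h ↦ ⟨⟨h.2.ne', h.1⟩, h.2⟩⟩
        have h₃ := Finset.card_erase_add_one (Finset.mem_sdiff.2 ⟨hvT, hv.2⟩)
        have h₄ := Finset.card_sdiff_add_card_eq_card hRT
        rw [h₂] at h₁
        lia
      · exact (hTZ.mono_left hRT).symm
      · rw [Finset.disjoint_left]
        intro u hu
        simp only [Finset.mem_filter, Finset.mem_sdiff, Finset.mem_union] at hu ⊢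
        obtain hu | hu := hu
        · have := Finset.disjoint_right.1 hTZ hu
          tauto
        · tauto
    · intro u hu huR
      simp only [Finset.mem_filter, Finset.mem_erase, Finset.mem_sdiff]
      tauto
    · intro u
      simp only [Finset.mem_filter, Finset.mem_erase, Finset.mem_sdiff]
      tauto
  · have hsub : (A \ insert v R).card < k := by
      rw [← hk]
      refine Finset.card_lt_card ⟨Finset.sdiff_subset_sdiff le_rfl (Finset.subset_insert _ _), ?_⟩
      intro h
      have := h (Finset.mem_sdiff.2 hv)
      simp at this
    have := ih _ hsub (insert v R) (Finset.insert_subset hv.1 hR) (by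
      obtain h | h := hvB
      · exact .inl (Finset.insert_subset h.2 h.1)
      · exact .inr (h.2.trans (Finset.subset_insert _ _))) rfl
    rwa [Finset.sdiff_insert, Finset.union_insert] at this

theorem exists_large_color {ι : Type} [Fintype ι] [Nonempty ι] [DecidableEq ι] (A : Finset V)
    (C : V → ι) : ∃ k, A.card ≤ Fintype.card ι * (A.filter fun v ↦ C v = k).card := by
  by_contra! h
  have h₁ := Finset.card_eq_sum_card_fiberwise (s := A) (t := Finset.univ) (f := C)
    (fun _ _ ↦ Finset.mem_coe.2 (Finset.mem_univ _))
  have h₂ : ∑ k : ι, Fintype.card ι * (A.filter fun v ↦ C v = k).card < ∑ _k : ι, A.card :=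
    Finset.sum_lt_sum_of_nonempty Finset.univ_nonempty fun k _ ↦ h k
  rw [← Finset.mul_sum, ← h₁, Finset.sum_const, Finset.card_univ, smul_eq_mul] at h₂
  exact lt_irrefl _ h₂

theorem card_filter_adj_le_ncard [Finite V] [DecidableRel G.Adj] (T : Finset V) (v : V) :
    (T.filter (G.Adj v)).card ≤ (G.neighborSet v).ncard := by
  rw [← Set.ncard_coe_finset]
  exact Set.ncard_le_ncard (fun u hu ↦ (Finset.mem_filter.1 hu).2) (Set.toFinite _)

/-- The projective dimension is at most the integer part of `|Z| + |T| - |T| / c`. -/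
theorem edgeVarPdLE_of_coloring [Finite V] {χ : ℕ} (hχ : χ ≠ 0) (C : Gᶜ.Coloring (Fin χ))
    {c : ℝ} (hc : 1 ≤ c)
    (hdeg : ∀ u v, G.Adj u v → ((G.neighborSet u).ncard : ℝ) +
      ((χ : ℝ) - 1) / χ * (G.neighborSet v).ncard + 1 ≤ c)
    (T Z : Finset V) (hTZ : Disjoint T Z) (n : ℕ)
    (hn : (T.card + Z.card : ℝ) - T.card / c < n + 1) : EdgeVarPdLE K G T Z n := by
  classical
  have hχ1 : (1 : ℝ) ≤ χ := by exact_mod_cast Nat.one_le_iff_ne_zero.2 hχ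
  have hα : 0 ≤ ((χ : ℝ) - 1) / χ := div_nonneg (by linarith) (by linarith)
  have : Nonempty (Fin χ) := ⟨⟨0, Nat.pos_of_ne_zero hχ⟩⟩
  have hC (u v : V) (huv : C u = C v) : u = v ∨ G.Adj u v := by
    by_contra! h
    exact C.valid ((SimpleGraph.compl_adj _ _ _).2 h) huv
  induction hk : T.card using Nat.strong_induction_on generalizing T Z with
  | _ k ih =>
  obtain rfl | ⟨y, hy⟩ := T.eq_empty_or_nonempty
  · refine (edgeVarPdLE_empty Z).mono ?_
    rw [Finset.card_empty, Nat.cast_zero, zero_add, zero_div, sub_zero] at hn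
    exact Nat.lt_succ_iff.1 (by exact_mod_cast hn)
  have hIH (T' Z' : Finset V) (hd : Disjoint T' Z')
      (hcard : T'.card + Z'.card + 1 = T.card + Z.card) (hlt : T'.card < T.card)
      (hle : (T.card : ℝ) ≤ T'.card + c) : EdgeVarPdLE K G T' Z' n := by
    refine ih _ (hk ▸ hlt) T' Z' hd ?_ rfl
    have h₁ : (T'.card + Z'.card + 1 : ℝ) = T.card + Z.card := by exact_mod_cast hcard
    have h₂ : (T.card : ℝ) / c ≤ T'.card / c + 1 := by
      rw [div_add_one (by linarith)]
      exact div_le_div_of_nonneg_right hle (by linarith)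
    linarith
  set A := T.filter (G.Adj y) with hA
  have hAy : (A.card : ℝ) ≤ (G.neighborSet y).ncard := by
    exact_mod_cast card_filter_adj_le_ncard T y
  obtain ⟨k₀, hk₀⟩ := exists_large_color A C
  rw [Fintype.card_fin] at hk₀
  set B := A.filter fun v ↦ C v ≠ k₀ with hB
  have hBcard : (B.card : ℝ) ≤ ((χ : ℝ) - 1) / χ * (G.neighborSet y).ncard := by
    refine le_trans ?_ (mul_le_mul_of_nonneg_left hAy hα)
    have h₁ : (A.card : ℝ) ≤ χ * (A.filter fun v ↦ C v = k₀).card := by exact_mod_cast hk₀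
    have h₂ : ((A.filter fun v ↦ C v = k₀).card + B.card : ℝ) = A.card := by
      exact_mod_cast Finset.card_filter_add_card_filter_not (s := A) fun v ↦ C v = k₀
    rw [div_mul_eq_mul_div, le_div_iff₀ (by linarith)]
    nlinarith
  have hAT : A ⊆ T := Finset.filter_subset _ _
  have hyA : y ∉ A := by simp [hA]
  have main := EdgeVarPdLE.chain (K := K) (G := G) (n := n) (B := B) hAT hTZ ?_ ?_ ∅
    (Finset.empty_subset _) (.inl (Finset.empty_subset _))
  · simpa using main
  · rw [EdgeVarPdLE, ← edgeVarIdeal_erase_of_isolated (w := y) (by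
      intro v hv hyv
      rw [Finset.mem_sdiff] at hv
      exact hv.2 (Finset.mem_filter.2 ⟨hv.1, hyv⟩))]
    have h₁ := Finset.card_erase_add_one (Finset.mem_sdiff.2 ⟨hy, hyA⟩)
    have h₂ := Finset.card_sdiff_add_card_eq_card hAT
    have h₃ : (Z ∪ A).card = Z.card + A.card :=
      Finset.card_union_of_disjoint (hTZ.mono_left hAT).symm
    refine hIH _ _ ?_ (by lia) (by lia) ?_
    · rw [Finset.disjoint_left]
      intro u hu
      simp only [Finset.mem_erase, Finset.mem_sdiff, Finset.mem_union] at hu ⊢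
      have := Finset.disjoint_left.1 hTZ hu.2.1
      tauto
    · have h₄ : (T.card : ℝ) = ((T \ A).erase y).card + (A.card + 1) := by
        exact_mod_cast (by lia)
      rw [h₄]
      gcongr
      obtain h | ⟨v, hv⟩ := A.eq_empty_or_nonempty
      · simpa [h] using hc
      · have := hdeg y v (Finset.mem_filter.1 hv).2
        have := mul_nonneg hα (Nat.cast_nonneg (α := ℝ) (G.neighborSet v).ncard)
        linarith
  · intro v hv R hR hvR hvB T' Z' hd hcard hT' hvT' hsub
    refine hIH T' Z' hd hcard (Finset.card_lt_card ⟨hsub, fun h ↦ hvT' (h (hAT hv))⟩) ?_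
    have hcov : T ⊆ T' ∪ (insert v (T.filter (G.Adj v)) ∪ B) := by
      intro u hu
      simp only [Finset.mem_union, Finset.mem_insert, Finset.mem_filter]
      by_contra! h
      obtain ⟨huT', ⟨huv, hau⟩, huB⟩ := h
      have huR : u ∈ R := by
        by_contra huR
        exact (hT' u hu huR huT').elim huv (hau hu)
      have huA := hR huR
      have hCu : C u = k₀ := by
        by_contra h
        exact huB (Finset.mem_filter.2 ⟨huA, h⟩)
      obtain h | h := hvB
      · exact huB (h.1 huR)
      · have hCv : C v = k₀ := by
          by_contra h'
          exact h (Finset.mem_filter.2 ⟨hv, h'⟩)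
        exact (hC v u (hCv.trans hCu.symm)).elim (fun h ↦ huv h.symm) (hau hu)
    have h₁ := (Finset.card_le_card hcov).trans (Finset.card_union_le _ _)
    have h₂ := Finset.card_union_le (insert v (T.filter (G.Adj v))) B
    have h₃ := Finset.card_insert_le v (T.filter (G.Adj v))
    have h₄ := card_filter_adj_le_ncard (G := G) T v
    have h₅ : (T.card : ℝ) ≤ T'.card + ((G.neighborSet v).ncard + 1 + B.card) := by
      exact_mod_cast (by lia)
    have := hdeg v y (Finset.mem_filter.1 hv).2.symm
    linarith

end

theorem stmt7 (K : Type) [Field K] {V : Type} [Fintype V] (G : SimpleGraph V)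
    (x y : V)
    (hmax : IsAlphaMaxEdge G ((((Gᶜ.chromaticNumber.toNat : ℕ) : ℝ) - 1) /
      ((Gᶜ.chromaticNumber.toNat : ℕ) : ℝ)) x y)
    (hde : (G.neighborSet y).ncard ≤ (G.neighborSet x).ncard) :
    ((graphPd K G : ℝ≥0∞) : EReal) ≤
      (((Fintype.card V : ℝ) *
        (1 - 1 / (((G.neighborSet x).ncard : ℝ)
          + (((Gᶜ.chromaticNumber.toNat : ℕ) : ℝ) - 1) / ((Gᶜ.chromaticNumber.toNat : ℕ) : ℝ)
            * ((G.neighborSet y).ncard : ℝ) + 1))) : EReal) := by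
  set χ := Gᶜ.chromaticNumber.toNat with hχdef
  have hcol : Gᶜ.Colorable χ := by
    refine SimpleGraph.chromaticNumber_le_iff_colorable.1 ?_
    rw [hχdef, ENat.natCast_toNat]
    exact SimpleGraph.chromaticNumber_ne_top_iff_exists.2 ⟨_, Gᶜ.colorable_of_fintype⟩
  obtain ⟨C⟩ := hcol
  have hχ : χ ≠ 0 := by
    intro h
    rw [h] at C
    exact (C x).elim0
  obtain ⟨hxy, hmax⟩ := hmax
  set c : ℝ := (G.neighborSet x).ncard + ((χ : ℝ) - 1) / χ * (G.neighborSet y).ncard + 1 with hcdef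
  have hχ1 : (1 : ℝ) ≤ χ := by exact_mod_cast Nat.one_le_iff_ne_zero.2 hχ
  have hα : 0 ≤ ((χ : ℝ) - 1) / χ := div_nonneg (by linarith) (by linarith)
  have hc : 1 ≤ c := by
    have := mul_nonneg hα (Nat.cast_nonneg (α := ℝ) (G.neighborSet y).ncard)
    have := Nat.cast_nonneg (α := ℝ) (G.neighborSet x).ncard
    linarith
  have hb : 0 ≤ (Fintype.card V : ℝ) * (1 - 1 / c) :=
    mul_nonneg (Nat.cast_nonneg _) (sub_nonneg.2 ((div_le_one (by linarith)).2 hc))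
  set b := (Fintype.card V : ℝ) * (1 - 1 / c) with hbdef
  have hpd : graphPd K G ≤ (⌊b⌋₊ : ℕ) := by
    have : EdgeVarPdLE K G Finset.univ ∅ ⌊b⌋₊ := by
      refine edgeVarPdLE_of_coloring hχ C hc (fun u v h ↦ ?_) _ _
        (Finset.disjoint_empty_right _) _ ?_
      · have := hmax u v h
        linarith
      · rw [Finset.card_univ, Finset.card_empty, Nat.cast_zero, add_zero,
          show (Fintype.card V : ℝ) - Fintype.card V / c = b by rw [hbdef]; ring]
        exact Nat.lt_floor_add_one b
    rw [EdgeVarPdLE, ← edgeIdeal_eq_edgeVarIdeal] at this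
    exact projDim_le _ _
  have hfloor : ((⌊b⌋₊ : ℝ) : EReal) ≤ (b : EReal) := EReal.coe_le_coe_iff.2 (Nat.floor_le hb)
  have hrhs : ((Fintype.card V : ℝ) : EReal) * (1 - 1 / ((c : ℝ) : EReal)) = (b : EReal) := by
    rw [hbdef]
    push_cast
    rfl
  have hcE : (c : EReal) = ((G.neighborSet x).ncard : ℝ)
      + (((χ : ℕ) : ℝ) - 1) / ((χ : ℕ) : ℝ) * ((G.neighborSet y).ncard : ℝ) + 1 := by
    rw [hcdef]
    push_cast
    rfl
  rw [← hcE, hrhs]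
  refine le_trans ?_ hfloor
  have hE : (graphPd K G : ℝ≥0∞) ≤ ((⌊b⌋₊ : ℕ) : ℝ≥0∞) := by
    exact_mod_cast ENat.toENNReal_le.2 hpd
  calc ((graphPd K G : ℝ≥0∞) : EReal) ≤ (((⌊b⌋₊ : ℕ) : ℝ≥0∞) : EReal) :=
        EReal.coe_ennreal_le_coe_ennreal_iff.2 hE
    _ = _ := by
        rw [← ENNReal.ofReal_natCast, EReal.coe_ennreal_ofReal, max_eq_left (Nat.cast_nonneg _)]
end

section
/- Let G be a finite simple graph on n vertices without isolated vertices. Then pd(G) ≤ n − ε(G). -/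
open CategoryTheory
open scoped ENNReal

/-- `A` is a dominating set: every vertex outside `A` has a neighbor in `A`. -/
def IsDominatingSet {V : Type} (G : SimpleGraph V) (A : Set V) : Prop :=
  ∀ v ∉ A, ∃ a ∈ A, G.Adj v a

/-- A set of vertices is independent if no two of its vertices are adjacent. -/
def IsIndepSet {V : Type} (G : SimpleGraph V) (A : Set V) : Prop :=
  ∀ u ∈ A, ∀ v ∈ A, ¬ G.Adj u v

/-- `γ(G)`: the minimum size of a dominating set. -/
noncomputable def domNum {V : Type} (G : SimpleGraph V) : ℕ :=
  sInf {n | ∃ A : Set V, IsDominatingSet G A ∧ A.ncard = n}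

/-- `i(G)`: the minimum size of an independent dominating set. -/
noncomputable def indDomNum {V : Type} (G : SimpleGraph V) : ℕ :=
  sInf {n | ∃ A : Set V, IsDominatingSet G A ∧ IsIndepSet G A ∧ A.ncard = n}

/-- `γ₀(X, G)`: the minimum size of a set `A` with `X ⊆ N(A)`. -/
noncomputable def gamma0Of {V : Type} (G : SimpleGraph V) (X : Set V) : ℕ :=
  sInf {n | ∃ A : Set V, (∀ x ∈ X, ∃ a ∈ A, G.Adj x a) ∧ A.ncard = n}

/-- `γ₀(G) = γ₀(V(G), G)`. -/
noncomputable def gamma0 {V : Type} (G : SimpleGraph V) : ℕ :=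
  gamma0Of G Set.univ

/-- `τ(G)`: the maximum of `γ₀(A, G)` over independent sets `A`. -/
noncomputable def tauNum {V : Type} (G : SimpleGraph V) : ℕ :=
  sSup {n | ∃ A : Set V, IsIndepSet G A ∧ gamma0Of G A = n}

/-- A set `F` of edges of `G` is edgewise dominant if every vertex of `G` is adjacent
to an endpoint of some edge in `F`. -/
def IsEdgewiseDominant {V : Type} (G : SimpleGraph V) (F : Set (Sym2 V)) : Prop :=
  F ⊆ G.edgeSet ∧ ∀ v : V, ∃ e ∈ F, ∃ w, w ∈ e ∧ G.Adj v w

/-- `ε(G)`: the minimum size of an edgewise dominant set of edges. -/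
noncomputable def epsilonNum {V : Type} (G : SimpleGraph V) : ℕ :=
  sInf {n | ∃ F : Set (Sym2 V), IsEdgewiseDominant G F ∧ F.ncard = n}

namespace CategoryTheory

open Limits

/-- The functor `Ext` obtained by deriving `Hom` vanishes in the degrees above the projective
dimension. -/
theorem isZero_ext_of_hasProjectiveDimensionLT {R : Type} [CommRing R] (M N : ModuleCat R)
    {n i : ℕ} [HasProjectiveDimensionLT M n] (hi : n ≤ i) (hpos : i ≠ 0) :
    IsZero (((Ext R (ModuleCat R) i).obj (Opposite.op M)).obj N) := by
  obtain ⟨p, rfl⟩ := Nat.exists_eq_succ_of_ne_zero hpos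
  let P := ProjectiveResolution.of M
  refine IsZero.of_iso ?_ (P.isoExt (p + 1) N)
  rw [← HomologicalComplex.exactAt_iff_isZero_homology,
    HomologicalComplex.exactAt_iff' _ p (p + 1) (p + 2) (by simp) (by simp),
    ShortComplex.moduleCat_exact_iff]
  intro f hf
  have hf' : P.complex.d (p + 2) (p + 1) ≫ f = 0 := hf
  have h0 : P.extMk f (p + 2) rfl hf' = 0 :=
    Abelian.Ext.eq_zero_of_hasProjectiveDimensionLT _ n hi
  obtain ⟨g, hg⟩ := (P.extMk_eq_zero_iff f (p + 2) rfl hf' p rfl).1 h0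
  exact ⟨g, hg⟩

end CategoryTheory

theorem projDim_le_of_hasProjectiveDimensionLE {R : Type} [CommRing R] (M : ModuleCat R)
    {n : ℕ} [HasProjectiveDimensionLE M n] : projDim R M ≤ n := by
  refine sSup_le ?_
  rintro _ ⟨i, N, rfl, hN⟩
  by_contra! h
  have hi : n < i := by exact_mod_cast h
  have h0 := isZero_ext_of_hasProjectiveDimensionLT M N (n := n + 1) hi (by omega)
  exact not_subsingleton_iff_nontrivial.2 hN (ModuleCat.subsingleton_of_isZero h0)

/-- The short exact sequence `0 → R ⧸ (I : x) → R ⧸ I → R ⧸ (I + (x)) → 0`. -/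
theorem exists_shortExact_quotient_colon {R : Type} [CommRing R] {I J L : Ideal R} {x : R}
    (hJ : ∀ f, x * f ∈ I ↔ f ∈ J) (hL : I ⊔ Ideal.span {x} = L) :
    ∃ S : ShortComplex (ModuleCat R), S.ShortExact ∧ S.X₁ = ModuleCat.of R (R ⧸ J) ∧
      S.X₂ = ModuleCat.of R (R ⧸ I) ∧ S.X₃ = ModuleCat.of R (R ⧸ L) := by
  let f : (R ⧸ J) →ₗ[R] (R ⧸ I) :=
    Submodule.mapQ J I (LinearMap.mulLeft R x) fun a ha => (hJ a).2 ha
  have hIL : I ≤ L := hL ▸ le_sup_left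
  let g : (R ⧸ I) →ₗ[R] (R ⧸ L) := Submodule.factor hIL
  have hfg : Function.Exact f g := by
    intro y
    obtain ⟨a, rfl⟩ := Submodule.mkQ_surjective _ y
    have h1 : g (Submodule.mkQ I a) = 0 ↔ a ∈ L := Submodule.Quotient.mk_eq_zero L
    rw [h1, ← hL]
    constructor
    · intro ha
      obtain ⟨b, hb, c, hc, rfl⟩ := Submodule.mem_sup.1 ha
      obtain ⟨d, rfl⟩ := Ideal.mem_span_singleton.1 hc
      refine ⟨Submodule.mkQ J d, ?_⟩
      refine (Submodule.Quotient.eq I).2 ?_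
      simpa using hb
    · rintro ⟨z, hz⟩
      obtain ⟨d, rfl⟩ := Submodule.mkQ_surjective _ z
      have h2 : x * d - a ∈ I := (Submodule.Quotient.eq I).1 hz
      refine Submodule.mem_sup.2 ⟨a - x * d, ?_, x * d, ?_, by ring⟩
      · simpa using I.neg_mem h2
      · exact Ideal.mem_span_singleton.2 ⟨d, rfl⟩
  refine ⟨ModuleCat.shortComplexOfCompEqZero f g hfg.linearMap_comp_eq_zero,
    ModuleCat.shortComplex_shortExact _ hfg ?_ ?_, rfl, rfl, rfl⟩
  · refine (injective_iff_map_eq_zero f).2 fun y hy => ?_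
    obtain ⟨a, rfl⟩ := Submodule.mkQ_surjective _ y
    have h2 : x * a ∈ I := (Submodule.Quotient.mk_eq_zero I).1 hy
    exact (Submodule.Quotient.mk_eq_zero J).2 ((hJ a).1 h2)
  · exact Submodule.factor_surjective hIL

section EdgeIdealDeletion

variable (K : Type) [Field K] {V : Type} (G : SimpleGraph V)

/-- The sum of the edge ideal of `G` and the ideal generated by the variables in `W`. -/
noncomputable def edgeIdealSup (W : Set V) : Ideal (MvPolynomial V K) :=
  edgeIdeal K G ⊔ Ideal.span (MvPolynomial.X '' W)

/-- The quotient of the polynomial ring by `edgeIdealSup`. -/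
noncomputable abbrev edgeQuotient (W : Set V) : ModuleCat (MvPolynomial V K) :=
  ModuleCat.of (MvPolynomial V K) (MvPolynomial V K ⧸ edgeIdealSup K G W)

variable {K G}

theorem mem_edgeIdealSup_iff {W : Set V} {f : MvPolynomial V K} :
    f ∈ edgeIdealSup K G W ↔ ∀ s ∈ f.support,
      (∃ u v, G.Adj u v ∧ s u ≠ 0 ∧ s v ≠ 0) ∨ ∃ w ∈ W, s w ≠ 0 := by
  classical
  have key : edgeIdealSup K G W = Ideal.span ((fun s => MvPolynomial.monomial s (1 : K)) ''
      ({s | ∃ u v, G.Adj u v ∧ s = Finsupp.single u 1 + Finsupp.single v 1} ∪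
        {s | ∃ w ∈ W, s = Finsupp.single w 1})) := by
    rw [edgeIdealSup, edgeIdeal, ← Ideal.span_union, Set.image_union]
    congr 2
    · ext m
      constructor
      · rintro ⟨u, v, h, rfl⟩
        exact ⟨_, ⟨u, v, h, rfl⟩, by simp [MvPolynomial.X, MvPolynomial.monomial_mul]⟩
      · rintro ⟨_, ⟨u, v, h, rfl⟩, rfl⟩
        exact ⟨u, v, h, by simp [MvPolynomial.X, MvPolynomial.monomial_mul]⟩
    · ext m
      constructor
      · rintro ⟨w, h, rfl⟩
        exact ⟨_, ⟨w, h, rfl⟩, rfl⟩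
      · rintro ⟨_, ⟨w, h, rfl⟩, rfl⟩
        exact ⟨w, h, rfl⟩
  rw [key, MvPolynomial.mem_ideal_span_monomial_image]
  refine forall₂_congr fun s _ => ?_
  constructor
  · rintro ⟨t, ⟨u, v, h, rfl⟩ | ⟨w, h, rfl⟩, ht⟩
    · refine Or.inl ⟨u, v, h, ?_, ?_⟩
      · have := ht u
        simp at this
        omega
      · have := ht v
        simp at this
        omega
    · refine Or.inr ⟨w, h, ?_⟩
      have := ht w
      simp at this
      omega
  · rintro (⟨u, v, h, hu, hv⟩ | ⟨w, h, hw⟩)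
    · refine ⟨_, Or.inl ⟨u, v, h, rfl⟩, fun a => ?_⟩
      have := h.ne
      simp only [Finsupp.add_apply, Finsupp.single_apply]
      split_ifs <;> first | (subst_vars; omega) | (subst_vars; exact absurd rfl this)
    · refine ⟨_, Or.inr ⟨w, h, rfl⟩, fun a => ?_⟩
      simp only [Finsupp.single_apply]
      split_ifs <;> (subst_vars; omega)

theorem X_mul_mem_edgeIdealSup_iff {W : Set V} {v : V} (hv : v ∉ W) (f : MvPolynomial V K) :
    MvPolynomial.X v * f ∈ edgeIdealSup K G W ↔
      f ∈ edgeIdealSup K G (W ∪ G.neighborSet v) := by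
  classical
  rw [mem_edgeIdealSup_iff, mem_edgeIdealSup_iff, MvPolynomial.support_X_mul]
  simp only [Finset.mem_map, addLeftEmbedding_apply, forall_exists_index, and_imp,
    forall_apply_eq_imp_iff₂]
  refine forall₂_congr fun s _ => ?_
  have hs : ∀ a, (Finsupp.single v 1 + s : V →₀ ℕ) a ≠ 0 ↔ a = v ∨ s a ≠ 0 := by
    intro a
    simp only [Finsupp.add_apply, Finsupp.single_apply]
    split_ifs with h
    · simp [h]
    · simp [Ne.symm h]
  simp only [hs]
  constructor
  · rintro (⟨a, b, h, rfl | ha, rfl | hb⟩ | ⟨w, h, rfl | hw⟩)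
    · exact absurd h (G.loopless.irrefl _)
    · exact Or.inr ⟨b, Or.inr h, hb⟩
    · exact Or.inr ⟨a, Or.inr h.symm, ha⟩
    · exact Or.inl ⟨a, b, h, ha, hb⟩
    · exact absurd h hv
    · exact Or.inr ⟨w, Or.inl h, hw⟩
  · rintro (⟨a, b, h, ha, hb⟩ | ⟨w, h | h, hw⟩)
    · exact Or.inl ⟨a, b, h, Or.inr ha, Or.inr hb⟩
    · exact Or.inr ⟨w, h, Or.inr hw⟩
    · exact Or.inl ⟨v, w, h, Or.inl rfl, Or.inr hw⟩

theorem edgeIdealSup_sup_span_X (W : Set V) (v : V) :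
    edgeIdealSup K G W ⊔ Ideal.span {MvPolynomial.X v} = edgeIdealSup K G (insert v W) := by
  rw [edgeIdealSup, edgeIdealSup, Set.image_insert_eq, Ideal.span_insert, sup_assoc,
    sup_comm (Ideal.span {_})]

theorem hasProjectiveDimensionLE_edgeQuotient {W : Set V} {v : V} (hv : v ∉ W) {n : ℕ}
    (h₁ : HasProjectiveDimensionLE (edgeQuotient K G (W ∪ G.neighborSet v)) n)
    (h₃ : HasProjectiveDimensionLE (edgeQuotient K G (insert v W)) n) :
    HasProjectiveDimensionLE (edgeQuotient K G W) n := by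
  obtain ⟨S, hS, e₁, e₂, e₃⟩ := exists_shortExact_quotient_colon
    (X_mul_mem_edgeIdealSup_iff (K := K) (G := G) hv) (edgeIdealSup_sup_span_X W v)
  have h₂ := hS.hasProjectiveDimensionLT_X₂ (n + 1) (by rwa [e₁]) (by rwa [e₃])
  rwa [e₂] at h₂

theorem hasProjectiveDimensionLE_edgeQuotient_insert {W : Set V} {v : V} (hv : v ∉ W)
    (hW : G.neighborSet v ⊆ W) {n : ℕ}
    (h : HasProjectiveDimensionLE (edgeQuotient K G W) n) :
    HasProjectiveDimensionLE (edgeQuotient K G (insert v W)) (n + 1) := by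
  obtain ⟨S, hS, e₁, e₂, e₃⟩ := exists_shortExact_quotient_colon
    (X_mul_mem_edgeIdealSup_iff (K := K) (G := G) hv) (edgeIdealSup_sup_span_X W v)
  rw [Set.union_eq_self_of_subset_right hW] at e₁
  have h₂ : HasProjectiveDimensionLE S.X₂ (n + 1) := by
    rw [e₂]
    exact hasProjectiveDimensionLT_of_ge _ (n + 1) _ (by omega)
  have h₃ := hS.hasProjectiveDimensionLT_X₃ (n + 1) (by rwa [e₁]) h₂
  rwa [e₃] at h₃

theorem hasProjectiveDimensionLE_edgeQuotient_bot (W : Finset V) :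
    HasProjectiveDimensionLE (edgeQuotient K (⊥ : SimpleGraph V) (W : Set V)) W.card := by
  classical
  induction W using Finset.induction_on with
  | empty =>
    have h0 : edgeIdealSup K (⊥ : SimpleGraph V) ((∅ : Finset V) : Set V) = ⊥ := by
      simp [edgeIdealSup, edgeIdeal]
    rw [edgeQuotient, h0]
    have : Projective (ModuleCat.of (MvPolynomial V K)
        (MvPolynomial V K ⧸ (⊥ : Ideal (MvPolynomial V K)))) :=
      (IsProjective.iff_projective _).1
        (Module.Projective.of_equiv (Submodule.quotEquivOfEqBot ⊥ rfl).symm)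
    exact (projective_iff_hasProjectiveDimensionLE_zero _).1 this
  | insert v W hv ih =>
    rw [Finset.card_insert_of_notMem hv, Finset.coe_insert]
    exact hasProjectiveDimensionLE_edgeQuotient_insert (by simpa using hv) (by simp) ih

theorem edgeIdealSup_eq_bot_of_cover {W : Set V} (hW : ∀ u v, G.Adj u v → u ∈ W ∨ v ∈ W) :
    edgeIdealSup K G W = edgeIdealSup K ⊥ W := by
  ext f
  rw [mem_edgeIdealSup_iff, mem_edgeIdealSup_iff]
  refine forall₂_congr fun s _ => ?_
  constructor
  · rintro (⟨u, v, h, hu, hv⟩ | h)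
    · rcases hW u v h with h | h
      · exact Or.inr ⟨u, h, hu⟩
      · exact Or.inr ⟨v, h, hv⟩
    · exact Or.inr h
  · rintro (⟨u, v, h, -⟩ | h)
    · exact absurd h id
    · exact Or.inr h

end EdgeIdealDeletion

section Domination

variable {V : Type} [Fintype V] (G : SimpleGraph V)

open Classical in
/-- The isolated vertices of the graph obtained from `G` by deleting the vertices in `W`. -/
noncomputable def isolatedAfter (W : Finset V) : Finset V :=
  {v | v ∉ W ∧ ∀ u, G.Adj v u → u ∈ W}

/-- A set of edges of `G`, given by pairs of endpoints, which dominates the non-isolated vertices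
of the graph obtained from `G` by deleting the vertices in `W`. -/
def DominatesOff (W : Finset V) (F : Finset (V × V)) : Prop :=
  (∀ e ∈ F, G.Adj e.1 e.2) ∧
    ∀ v ∉ W, (∃ u ∉ W, G.Adj v u) → ∃ e ∈ F, G.Adj v e.1 ∨ G.Adj v e.2

/-- Each set of edges dominating the non-isolated vertices of `G - W` has at least `m` elements,
up to the number of isolated vertices of `G - W`. -/
def DominationBound (m : ℕ) (W : Finset V) : Prop :=
  ∀ F, DominatesOff G W F → m ≤ (isolatedAfter G W).card + F.card

variable {G}

theorem mem_isolatedAfter {W : Finset V} {v : V} :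
    v ∈ isolatedAfter G W ↔ v ∉ W ∧ ∀ u, G.Adj v u → u ∈ W := by
  simp [isolatedAfter]

/-- Deleting neighbors of the two endpoints of an edge, so that one of the endpoints becomes
isolated, preserves lower bounds for domination. -/
theorem DominationBound.of_subset {m : ℕ} {W W' : Finset V} (h : DominationBound G m W)
    (hWW : W ⊆ W') {a b : V} (hab : G.Adj a b) (hb : b ∉ W) (ha : a ∈ isolatedAfter G W')
    (hnbr : ∀ x ∈ W', x ∉ W → (∃ u ∉ W, G.Adj x u) ∧ (G.Adj x a ∨ G.Adj x b)) :
    DominationBound G m W' := by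
  classical
  intro F hF
  obtain ⟨haW', haN⟩ := mem_isolatedAfter.1 ha
  set N := isolatedAfter G W' \ isolatedAfter G W with hN
  have hsub : isolatedAfter G W ⊆ isolatedAfter G W' := by
    intro x hx
    obtain ⟨hx1, hx2⟩ := mem_isolatedAfter.1 hx
    refine mem_isolatedAfter.2 ⟨fun hx' => ?_, fun u hu => hWW (hx2 u hu)⟩
    obtain ⟨u, hu, hxu⟩ := (hnbr x hx' hx1).1
    exact hu (hx2 u hxu)
  have hcard : N.card + (isolatedAfter G W).card = (isolatedAfter G W').card :=
    Finset.card_sdiff_add_card_eq_card hsub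
  have haN' : a ∈ N := by
    refine Finset.mem_sdiff.2 ⟨ha, fun h' => hb ((mem_isolatedAfter.1 h').2 b hab)⟩
  have hex : ∀ x ∈ N, ∃ u, G.Adj x u := by
    intro x hx
    obtain ⟨h1, h2⟩ := Finset.mem_sdiff.1 hx
    by_contra! h3
    exact h2 (mem_isolatedAfter.2 ⟨fun h4 => (mem_isolatedAfter.1 h1).1 (hWW h4),
      fun u hu => absurd hu (h3 u)⟩)
  have hφ : ∃ φ : V → V, φ a = b ∧ ∀ x ∈ N, G.Adj x (φ x) := by
    choose! φ hφ using hex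
    refine ⟨Function.update φ a b, by simp, fun x hx => ?_⟩
    by_cases hxa : x = a
    · subst hxa; simpa using hab
    · simpa [hxa] using hφ x hx
  obtain ⟨φ, hφa, hφ⟩ := hφ
  have hdom : DominatesOff G W (F ∪ N.image fun x => (x, φ x)) := by
    constructor
    · intro e he
      rcases Finset.mem_union.1 he with he | he
      · exact hF.1 e he
      · obtain ⟨x, hx, rfl⟩ := Finset.mem_image.1 he
        exact hφ x hx
    · rintro x hxW ⟨u, huW, hxu⟩
      by_cases hxW' : x ∈ W'
      · refine ⟨(a, φ a), Finset.mem_union_right _ (Finset.mem_image_of_mem _ haN'), ?_⟩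
        rw [hφa]
        exact (hnbr x hxW' hxW).2
      by_cases hx : ∃ u ∉ W', G.Adj x u
      · obtain ⟨e, he, h⟩ := hF.2 x hxW' hx
        exact ⟨e, Finset.mem_union_left _ he, h⟩
      · push Not at hx
        have hxN : x ∈ N := by
          refine Finset.mem_sdiff.2 ⟨mem_isolatedAfter.2 ⟨hxW', fun u hu => ?_⟩,
            fun h' => huW ((mem_isolatedAfter.1 h').2 u hxu)⟩
          by_contra hu'
          exact hx u hu' hu
        exact ⟨(x, φ x), Finset.mem_union_right _ (Finset.mem_image_of_mem _ hxN),
          Or.inr (hφ x hxN)⟩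
  have h1 := h _ hdom
  have h2 := Finset.card_union_le F (N.image fun x => (x, φ x))
  have h3 : (N.image fun x => (x, φ x)).card ≤ N.card := Finset.card_image_le
  omega

theorem dominationBound_epsilonNum (hiso : ∀ v : V, ∃ w, G.Adj v w) :
    DominationBound G (epsilonNum G) ∅ := by
  classical
  intro F hF
  have hdom : IsEdgewiseDominant G
      ((F.image fun e => s(e.1, e.2) : Finset (Sym2 V)) : Set (Sym2 V)) := by
    constructor
    · intro e he
      obtain ⟨p, hp, rfl⟩ := Finset.mem_image.1 he
      exact hF.1 p hp
    · intro v
      obtain ⟨w, hw⟩ := hiso v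
      obtain ⟨e, he, h⟩ := hF.2 v (by simp) ⟨w, by simp, hw⟩
      refine ⟨s(e.1, e.2), Finset.mem_image_of_mem _ he, ?_⟩
      rcases h with h | h
      · exact ⟨e.1, by simp, h⟩
      · exact ⟨e.2, by simp, h⟩
  have h1 : epsilonNum G ≤ _ := Nat.sInf_le ⟨_, hdom, rfl⟩
  rw [Set.ncard_coe_finset] at h1
  have h2 : (F.image fun e => s(e.1, e.2)).card ≤ F.card := Finset.card_image_le
  omega

theorem exists_hasProjectiveDimensionLE_edgeQuotient (K : Type) [Field K] {m : ℕ}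
    (W : Finset V) (h : DominationBound G m W) :
    ∃ p, p + m ≤ Fintype.card V ∧ HasProjectiveDimensionLE (edgeQuotient K G (W : Set V)) p := by
  classical
  induction hn : Wᶜ.card using Nat.strong_induction_on generalizing W with
  | _ n ih =>
  have ih' : ∀ W' : Finset V, W ⊂ W' → DominationBound G m W' → ∃ p, p + m ≤ Fintype.card V ∧
      HasProjectiveDimensionLE (edgeQuotient K G (W' : Set V)) p := fun W' hW' h' =>
    ih _ (hn ▸ Finset.card_lt_card (compl_lt_compl_iff_lt.2 hW')) W' h' rfl
  by_cases hE : ∃ z ∉ W, ∃ y ∉ W, G.Adj z y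
  swap
  · push Not at hE
    have hcover : ∀ u v, G.Adj u v → u ∈ (W : Set V) ∨ v ∈ (W : Set V) := by
      intro u v huv
      by_contra! h'
      exact hE u h'.1 v h'.2 huv
    refine ⟨W.card, ?_, ?_⟩
    · have h1 := h ∅ ⟨by simp, fun v hv ⟨u, hu, hvu⟩ => absurd hvu (hE v hv u hu)⟩
      have h2 : isolatedAfter G W ⊆ Wᶜ := fun v hv =>
        Finset.mem_compl.2 (mem_isolatedAfter.1 hv).1
      have h3 := Finset.card_le_card h2
      have h4 := W.card_add_card_compl
      simp only [Finset.card_empty] at h1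
      omega
    · rw [edgeQuotient, edgeIdealSup_eq_bot_of_cover hcover]
      exact hasProjectiveDimensionLE_edgeQuotient_bot W
  obtain ⟨z, hz, y, hy, hzy⟩ := hE
  -- Delete the neighbors of `z` one at a time.
  suffices key : ∀ (k : ℕ) (A : Finset V), (∀ v ∈ A, v ∉ W ∧ G.Adj z v) →
      (W ∪ A)ᶜ.card = k → ∃ p, p + m ≤ Fintype.card V ∧
        HasProjectiveDimensionLE (edgeQuotient K G ((W ∪ A : Finset V) : Set V)) p by
    simpa using key _ ∅ (by simp) rfl
  intro k
  induction k using Nat.strong_induction_on with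
  | _ k ihk =>
  intro A hA hk
  have hzA : z ∉ W ∪ A := fun h' => (Finset.mem_union.1 h').elim hz
    fun h'' => (hA z h'').2.ne rfl
  by_cases hall : ∀ v, G.Adj z v → v ∈ W ∪ A
  · have hyA : y ∈ A := (Finset.mem_union.1 (hall y hzy)).resolve_left hy
    refine ih' _ ?_ (h.of_subset Finset.subset_union_left hzy hy
      (mem_isolatedAfter.2 ⟨hzA, hall⟩) ?_)
    · exact (Finset.ssubset_iff_of_subset Finset.subset_union_left).2
        ⟨y, hall y hzy, hy⟩
    · intro x hx hxW
      have hxA := (hA x ((Finset.mem_union.1 hx).resolve_left hxW)).2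
      exact ⟨⟨z, hz, hxA.symm⟩, Or.inl hxA.symm⟩
  push Not at hall
  obtain ⟨v, hzv, hv⟩ := hall
  have hvW : v ∉ W := fun h' => hv (Finset.mem_union_left _ h')
  obtain ⟨p₁, hp₁, h₁⟩ : ∃ p, p + m ≤ Fintype.card V ∧ HasProjectiveDimensionLE
      (edgeQuotient K G (((W ∪ A) ∪ G.neighborFinset v : Finset V) : Set V)) p := by
    have hzv' : z ∈ (W ∪ A) ∪ G.neighborFinset v := by simp [hzv.symm]
    refine ih' _ ?_ (h.of_subset ?_ hzv.symm hz
      (mem_isolatedAfter.2 ⟨?_, fun u hu => by simp [hu]⟩) ?_)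
    · refine (Finset.ssubset_iff_of_subset ?_).2 ⟨z, hzv', hz⟩
      exact Finset.subset_union_left.trans Finset.subset_union_left
    · exact Finset.subset_union_left.trans Finset.subset_union_left
    · simpa using hv
    · intro x hx hxW
      rcases Finset.mem_union.1 hx with hx | hx
      · have hxA := (hA x ((Finset.mem_union.1 hx).resolve_left hxW)).2
        exact ⟨⟨z, hz, hxA.symm⟩, Or.inr hxA.symm⟩
      · have hvx : G.Adj v x := by simpa using hx
        exact ⟨⟨v, hvW, hvx.symm⟩, Or.inl hvx.symm⟩
  obtain ⟨p₃, hp₃, h₃⟩ := ihk (W ∪ insert v A)ᶜ.card (by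
      rw [← hk]
      refine Finset.card_lt_card (compl_lt_compl_iff_lt.2 ?_)
      rw [Finset.union_insert]
      exact Finset.ssubset_insert hv) (insert v A) (by
      intro u hu
      rcases Finset.mem_insert.1 hu with rfl | hu
      · exact ⟨hvW, hzv⟩
      · exact hA u hu) rfl
  refine ⟨max p₁ p₃, by omega, ?_⟩
  rw [Finset.coe_union, SimpleGraph.coe_neighborFinset] at h₁
  rw [Finset.union_insert, Finset.coe_insert] at h₃
  refine hasProjectiveDimensionLE_edgeQuotient (v := v) (by simpa using hv) ?_ ?_
  · exact hasProjectiveDimensionLT_of_ge _ (p₁ + 1) _ (by omega)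
  · exact hasProjectiveDimensionLT_of_ge _ (p₃ + 1) _ (by omega)

end Domination

/-- pd(G) ≤ n - ε(G), stated as pd(G) + ε(G) ≤ n. -/
theorem stmt9 (K : Type) [Field K] {V : Type} [Fintype V] (G : SimpleGraph V)
    (hiso : ∀ v : V, ∃ w, G.Adj v w) :
    graphPd K G + (epsilonNum G : ℕ∞) ≤ (Fintype.card V : ℕ∞) := by
  obtain ⟨p, hp, h⟩ := exists_hasProjectiveDimensionLE_edgeQuotient K ∅
    (dominationBound_epsilonNum hiso)
  have h0 : edgeIdealSup K G ((∅ : Finset V) : Set V) = edgeIdeal K G := by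
    simp [edgeIdealSup]
  rw [edgeQuotient, h0] at h
  calc graphPd K G + (epsilonNum G : ℕ∞) ≤ (p : ℕ∞) + (epsilonNum G : ℕ∞) :=
        add_le_add_left (projDim_le_of_hasProjectiveDimensionLE _) _
    _ ≤ (Fintype.card V : ℕ∞) := by exact_mod_cast hp
end
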